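/- arXiv:2509.01623 — 8 statements merged into one kernel-verified Lean document; each statement's English description precedes it below -/
import Mathlib

section
/- Let u = (u₁,u₂), v = (v₁,v₂) : ℝ → ℝ² be smooth unit vector fields with u₁(x) < 0, u₂(x) > 0, v₁(x) > 0, v₂(x) > 0 for all x ∈ ℝ. Let f̃ ∈ C^∞(ℝ) ∩ L¹(ℝ), let f(x,y) = f̃(x) on ℝ²₊, and set g(x) = ∫_x^∞ f̃(t) dt, α(x) = 1/u₁(x) + 1/v₁(x), β(x) = 1 − 1/v₁(x), ζ(x) = (u₁'(x)/u₁(x)²)·∫_{−∞}^∞ f̃(t) dt. Then for all x ∈ ℝ and d ≥ 0: (i) ∂_d Rf(x,d) = (1 − 1/v₁(x+d))·f̃(x+d) − (v₁'(x+d)/v₁(x+d)²)·g(x+d); (ii) ∂_x Rf(x,0) = ζ(x) − α(x)·f̃(x) + α'(x)·g(x); and (iii) ∂_d Rf(x,d)|_{d=0} = β(x)·f̃(x) − β'(x)·g(x). -/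
open MeasureTheory Set

theorem setIntegral_Ioi_comp_add_mul {a : ℝ} (ha : 0 < a) (φ : ℝ → ℝ) (x : ℝ) :
    ∫ t in Ioi (0 : ℝ), φ (x + t * a) = 1 / a * ∫ t in Ioi x, φ t := by
  have h := integral_comp_mul_left_Ioi (fun s => φ (x + s)) 0 ha
  have h' := (measurePreserving_add_left volume x).setIntegral_preimage_emb
    (measurableEmbedding_addLeft x) φ (Ioi x)
  simp only [preimage_const_add_Ioi, sub_self] at h'
  simp only [mul_zero, smul_eq_mul, h'] at h
  simpa only [mul_comm, one_div] using h

theorem setIntegral_Ioi_comp_add_mul_of_neg {a : ℝ} (ha : a < 0) (φ : ℝ → ℝ) (x : ℝ) :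
    ∫ t in Ioi (0 : ℝ), φ (x + t * a) = -(1 / a) * ∫ t in Iic x, φ t := by
  have h := setIntegral_Ioi_comp_add_mul (neg_pos.mpr ha) (fun s => φ (-s)) (-x)
  rw [integral_comp_neg_Ioi, neg_neg] at h
  rw [← one_div_neg_eq_neg_one_div, ← h]
  congr 1 with t
  congr 1
  ring

theorem hasDerivAt_setIntegral_Iic {φ : ℝ → ℝ} (hc : Continuous φ) (hi : Integrable φ) (x : ℝ) :
    HasDerivAt (fun y => ∫ t in Iic y, φ t) (φ x) x := by
  have h : (fun y => ∫ t in Iic y, φ t) =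
      fun y => (∫ t in Iic 0, φ t) + ∫ t in (0 : ℝ)..y, φ t := by
    funext y
    rw [← intervalIntegral.integral_Iic_sub_Iic hi.integrableOn hi.integrableOn]
    ring
  rw [h]
  exact (hc.integral_hasStrictDerivAt 0 x).hasDerivAt.const_add _

theorem hasDerivAt_setIntegral_Ioi {φ : ℝ → ℝ} (hc : Continuous φ) (hi : Integrable φ) (x : ℝ) :
    HasDerivAt (fun y => ∫ t in Ioi y, φ t) (-φ x) x := by
  have h : (fun y => ∫ t in Ioi y, φ t) = fun y => (∫ t, φ t) - ∫ t in Iic y, φ t := by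
    funext y
    rw [← intervalIntegral.integral_Iic_add_Ioi (b := y) hi.integrableOn hi.integrableOn]
    ring
  rw [h]
  exact (hasDerivAt_setIntegral_Iic hc hi x).const_sub _

/-- Derivative formulas for the 2d head wave transform of a depth-independent function. -/
theorem stmt_1
    (u1 u2 v1 v2 : ℝ → ℝ)
    (hu1 : ContDiff ℝ (⊤ : ℕ∞) u1) (hu2 : ContDiff ℝ (⊤ : ℕ∞) u2)
    (hv1 : ContDiff ℝ (⊤ : ℕ∞) v1) (hv2 : ContDiff ℝ (⊤ : ℕ∞) v2)
    (hu_unit : ∀ x, u1 x ^ 2 + u2 x ^ 2 = 1)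
    (hv_unit : ∀ x, v1 x ^ 2 + v2 x ^ 2 = 1)
    (hu1_neg : ∀ x, u1 x < 0) (hu2_pos : ∀ x, 0 < u2 x)
    (hv1_pos : ∀ x, 0 < v1 x) (hv2_pos : ∀ x, 0 < v2 x)
    (ftil : ℝ → ℝ) (hftil_smooth : ContDiff ℝ (⊤ : ℕ∞) ftil) (hftil_int : Integrable ftil)
    (f : ℝ × ℝ → ℝ) (hf : ∀ x y : ℝ, 0 ≤ y → f (x, y) = ftil x)
    (R : ℝ → ℝ → ℝ)
    (hR : ∀ x d, R x d =
      (∫ t in Ioi (0:ℝ), f ((x, 0) + t • (u1 x, u2 x)))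
      + (∫ t in (0:ℝ)..d, f (x + t, 0))
      + ∫ t in Ioi (0:ℝ), f ((x + d, 0) + t • (v1 (x + d), v2 (x + d))))
    (g α β ζ : ℝ → ℝ)
    (hg : ∀ x, g x = ∫ t in Ioi x, ftil t)
    (hα : ∀ x, α x = 1 / u1 x + 1 / v1 x)
    (hβ : ∀ x, β x = 1 - 1 / v1 x)
    (hζ : ∀ x, ζ x = deriv u1 x / (u1 x) ^ 2 * ∫ t : ℝ, ftil t) :
    ∀ x d : ℝ, 0 ≤ d →
      (deriv (fun d' => R x d') d =
        (1 - 1 / v1 (x + d)) * ftil (x + d)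
          - deriv v1 (x + d) / (v1 (x + d)) ^ 2 * g (x + d)) ∧
      (deriv (fun x' => R x' 0) x = ζ x - α x * ftil x + deriv α x * g x) ∧
      (deriv (fun d' => R x d') 0 = β x * ftil x - deriv β x * g x) := by
  have hc := hftil_smooth.continuous
  have htop : ((⊤ : ℕ∞) : WithTop ℕ∞) ≠ 0 := by simp
  have du (x) : HasDerivAt (fun y => 1 / u1 y) (-deriv u1 x / u1 x ^ 2) x := by
    simpa only [one_div] using
      ((hu1.differentiable htop x).hasDerivAt.fun_inv (hu1_neg x).ne)
  have dv (x) : HasDerivAt (fun y => 1 / v1 y) (-deriv v1 x / v1 x ^ 2) x := by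
    simpa only [one_div] using
      ((hv1.differentiable htop x).hasDerivAt.fun_inv (hv1_pos x).ne')
  have dF := hasDerivAt_setIntegral_Iic hc hftil_int
  have dg (x) : HasDerivAt g (-ftil x) x := by
    rw [funext hg]
    exact hasDerivAt_setIntegral_Ioi hc hftil_int x
  have hFg (x) : ∫ t, ftil t = (∫ t in Iic x, ftil t) + g x := by
    rw [hg, intervalIntegral.integral_Iic_add_Ioi hftil_int.integrableOn hftil_int.integrableOn]
  have hR' (x d) : R x d = -(1 / u1 x) * (∫ t in Iic x, ftil t) + (∫ t in x..x + d, ftil t)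
      + 1 / v1 (x + d) * g (x + d) := by
    have ray {a b : ℝ} (hb : 0 < b) (x : ℝ) :
        ∫ t in Ioi (0 : ℝ), f ((x, 0) + t • (a, b)) = ∫ t in Ioi (0 : ℝ), ftil (x + t * a) := by
      refine setIntegral_congr_fun measurableSet_Ioi fun t ht => ?_
      have ht' : 0 ≤ 0 + t * b := by
        have := mul_pos (mem_Ioi.mp ht) hb
        linarith
      simpa using hf (x + t * a) _ ht'
    rw [hR, ray (hu2_pos x), ray (hv2_pos _), setIntegral_Ioi_comp_add_mul_of_neg (hu1_neg x),
      setIntegral_Ioi_comp_add_mul (hv1_pos _), hg]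
    simp [hf _ 0 le_rfl]
  have hd (x d) : deriv (fun d' => R x d') d = (1 - 1 / v1 (x + d)) * ftil (x + d)
      - deriv v1 (x + d) / v1 (x + d) ^ 2 * g (x + d) := by
    have h : HasDerivAt (fun y => -(1 / u1 x) * (∫ t in Iic x, ftil t) + (∫ t in x..y, ftil t)
        + 1 / v1 y * g y) _ (x + d) :=
      ((hc.integral_hasStrictDerivAt x (x + d)).hasDerivAt.const_add _).add
        ((dv (x + d)).mul (dg (x + d)))
    simp only [hR']
    rw [(h.comp_const_add x d).deriv]
    ring
  refine fun x d _ => ⟨hd x d, ?_, ?_⟩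
  · have h : HasDerivAt (fun y => -(1 / u1 y) * (∫ t in Iic y, ftil t) + 1 / v1 y * g y) _ x :=
      ((du x).neg.mul (dF x)).add ((dv x).mul (dg x))
    have hα' : deriv α x = -deriv u1 x / u1 x ^ 2 + -deriv v1 x / v1 x ^ 2 := by
      rw [funext hα]
      exact ((du x).add (dv x)).deriv
    simp only [hR', add_zero, intervalIntegral.integral_same]
    rw [h.deriv, hα', hζ, hα, hFg x]
    simp only [Pi.neg_apply]
    ring
  · have hβ' : deriv β x = -(-deriv v1 x / v1 x ^ 2) := by
      rw [funext hβ]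
      exact ((dv x).const_sub 1).deriv
    rw [hd, hβ', hβ, add_zero]
    ring
end

section
/- Let u = (u₁,u₂), v = (v₁,v₂) ∈ ℝ² be constant unit vectors with u₁ < 0, u₂ > 0, v₁ > 0, v₂ > 0. Let f̃ ∈ C^∞(ℝ) ∩ L¹(ℝ) and let f(x,y) = f̃(x) on ℝ²₊. Then for every x ∈ ℝ and every d ≥ 0, f̃(x) = (u₁/(1+u₁))·(∂_d Rf(x,d) − ∂_x Rf(x,d)). (Note u₁ > −1 automatically since u₂ > 0 and |u| = 1.) -/
open MeasureTheory Set

/-- Translating a half-line integral: the derivative is minus the value at the endpoint. -/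
theorem hasDerivAt_integral_Ioi_add {g : ℝ → ℝ} (hg : Continuous g) (hi : Integrable g) (x : ℝ) :
    HasDerivAt (fun y => ∫ t in Ioi (0:ℝ), g (y + t)) (-g x) x := by
  have key : ∀ y : ℝ, ∫ t in Ioi (0:ℝ), g (y + t) =
      (∫ s in Ioi (0:ℝ), g s) - ∫ s in (0:ℝ)..y, g s := by
    intro y
    have hshift : ∫ t in Ioi (0:ℝ), g (y + t) = ∫ s in Ioi y, g s := by
      have h := (measurePreserving_add_left volume y).setIntegral_preimage_emb
        (measurableEmbedding_addLeft y) g (Ioi y)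
      simpa using h
    rw [hshift, ← intervalIntegral.integral_Ioi_sub_Ioi' hi.integrableOn hi.integrableOn]
    ring
  simp_rw [key]
  exact (hg.integral_hasStrictDerivAt 0 x).hasDerivAt.const_sub _

/-- The derivative of a ray integral with nonzero slope with respect to its starting point. -/
theorem hasDerivAt_integral_Ioi_add_mul {g : ℝ → ℝ} (hg : Continuous g) (hi : Integrable g)
    {b : ℝ} (hb : b ≠ 0) (x : ℝ) :
    HasDerivAt (fun y => ∫ t in Ioi (0:ℝ), g (y + t * b)) (-(g x / b)) x := by
  have h := (hasDerivAt_integral_Ioi_add (g := fun s => g (b * s)) (by fun_prop)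
    (hi.comp_mul_left' hb) (x / b)).comp x ((hasDerivAt_id x).div_const b)
  refine (h.congr_of_eventuallyEq (Filter.Eventually.of_forall fun y => ?_)).congr_deriv ?_
  · refine integral_congr_ae (Filter.Eventually.of_forall fun t => ?_)
    change g (y + t * b) = g (b * (y / b + t))
    congr 1
    field_simp
  · rw [mul_div_cancel₀ x hb]
    ring

/-- Inversion formula via a combination of derivatives at general d ≥ 0,
    for constant direction vectors. -/
theorem stmt_4
    (u1 u2 v1 v2 : ℝ)
    (hu_unit : u1 ^ 2 + u2 ^ 2 = 1) (hv_unit : v1 ^ 2 + v2 ^ 2 = 1)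
    (hu1_neg : u1 < 0) (hu2_pos : 0 < u2)
    (hv1_pos : 0 < v1) (hv2_pos : 0 < v2)
    (ftil : ℝ → ℝ) (hftil_smooth : ContDiff ℝ (⊤ : ℕ∞) ftil) (hftil_int : Integrable ftil)
    (f : ℝ × ℝ → ℝ) (hf : ∀ x y : ℝ, 0 ≤ y → f (x, y) = ftil x)
    (R : ℝ → ℝ → ℝ)
    (hR : ∀ x d, R x d =
      (∫ t in Ioi (0:ℝ), f ((x, 0) + t • (u1, u2)))
      + (∫ t in (0:ℝ)..d, f (x + t, 0))
      + ∫ t in Ioi (0:ℝ), f ((x + d, 0) + t • (v1, v2))) :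
    ∀ x d : ℝ, 0 ≤ d →
      ftil x = u1 / (1 + u1) *
        (deriv (fun d' => R x d') d - deriv (fun x' => R x' d) x) := by
  intro x d _
  have hc : Continuous ftil := hftil_smooth.continuous
  have hR' : ∀ x d, R x d = (∫ t in Ioi (0:ℝ), ftil (x + t * u1))
      + ((∫ s in (0:ℝ)..(x + d), ftil s) - ∫ s in (0:ℝ)..x, ftil s)
      + ∫ t in Ioi (0:ℝ), ftil (x + d + t * v1) := by
    intro x d
    rw [hR]
    congr 1
    · congr 1
      · refine setIntegral_congr_fun measurableSet_Ioi fun t ht => ?_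
        have ht' : 0 < t := ht
        simpa using hf (x + t * u1) (0 + t * u2) (by positivity)
      · simp_rw [hf _ 0 le_rfl]
        rw [intervalIntegral.integral_interval_sub_left (hc.intervalIntegrable _ _)
          (hc.intervalIntegrable _ _)]
        simp
    · refine setIntegral_congr_fun measurableSet_Ioi fun t ht => ?_
      have ht' : 0 < t := ht
      simpa using hf (x + d + t * v1) (0 + t * v2) (by positivity)
  simp_rw [hR']
  have hU := hasDerivAt_integral_Ioi_add_mul hc hftil_int hu1_neg.ne x
  have hV := hasDerivAt_integral_Ioi_add_mul hc hftil_int hv1_pos.ne' (x + d)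
  have hP (y : ℝ) : HasDerivAt (fun z => ∫ s in (0:ℝ)..z, ftil s) (ftil y) y :=
    (hc.integral_hasStrictDerivAt 0 y).hasDerivAt
  have hD := (((hP (x + d)).comp_const_add x d).sub_const (∫ s in (0:ℝ)..x, ftil s)).const_add
    (∫ t in Ioi (0:ℝ), ftil (x + t * u1)) |>.add (hV.comp_const_add x d)
  have hX := (hU.add (((hP (x + d)).comp_add_const x d).sub (hP x))).add (hV.comp_add_const x d)
  have hne : 1 + u1 ≠ 0 := by nlinarith [sq_pos_of_pos hu2_pos]
  have eD := hD.deriv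
  have eX := hX.deriv
  simp only [Pi.add_def, Pi.sub_def] at eD eX
  rw [eD, eX]
  have hu := hu1_neg.ne
  have hv := hv1_pos.ne'
  field_simp
  ring
end

section
/- Let u = (u₁,u₂), v = (v₁,v₂) ∈ ℝ² be constant unit vectors with u₁ < 0, u₂ > 0, v₁ > 0, v₂ > 0. Let f̃ ∈ C_c^∞(ℝ) and let f(x,y) = f̃(x) on ℝ²₊. Fix d₀ > 0. If Rf(x,d₀) = 0 for all x ∈ ℝ, then f̃ ≡ 0. (Indeed, ∂_x Rf(x,d₀) = 0 gives f̃(x+d₀) = C·f̃(x) with C = (v₁/u₁)·(u₁+1)/(v₁−1), hence f̃(x+m d₀) = C^m f̃(x) for all m ∈ ℕ, which forces f̃ = 0 by compact support.) -/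
open MeasureTheory Set

/-- The integral of a continuous compactly supported function along the ray `t ↦ x + t * c`,
in terms of a primitive. -/
theorem exists_integral_Ioi_ray_eq {g : ℝ → ℝ} (hg : Continuous g) (hs : HasCompactSupport g)
    {c : ℝ} (hc : c ≠ 0) :
    ∃ K : ℝ, ∀ x : ℝ, ∫ t in Ioi (0:ℝ), g (x + t * c) = (K - ∫ s in (0:ℝ)..x, g s) / c := by
  have hint : Integrable g := hg.integrable_of_hasCompactSupport hs
  obtain ⟨K, hK⟩ : ∃ K : ℝ, ∀ x : ℝ, Filter.Tendsto
      (fun t : ℝ => ∫ s in (0:ℝ)..(x + t * c), g s) Filter.atTop (nhds K) := by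
    rcases lt_or_gt_of_ne hc with h | h
    · refine ⟨-∫ s in Iic (0:ℝ), g s, fun x => ?_⟩
      have ht : Filter.Tendsto (fun t : ℝ => x + t * c) Filter.atTop Filter.atBot :=
        Filter.tendsto_atBot_add_const_left _ _ (Filter.tendsto_id.atTop_mul_const_of_neg h)
      refine (intervalIntegral_tendsto_integral_Iic (0:ℝ) hint.integrableOn ht).neg.congr
        fun t => ?_
      rw [intervalIntegral.integral_symm, neg_neg]
    · refine ⟨∫ s in Ioi (0:ℝ), g s, fun x => ?_⟩
      exact intervalIntegral_tendsto_integral_Ioi (0:ℝ) hint.integrableOn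
        (Filter.tendsto_atTop_add_const_left _ _ (Filter.tendsto_id.atTop_mul_const h))
  refine ⟨K, fun x => ?_⟩
  have hderiv : ∀ t : ℝ,
      HasDerivAt (fun t : ℝ => (∫ s in (0:ℝ)..(x + t * c), g s) / c) (g (x + t * c)) t := by
    intro t
    have h1 : HasDerivAt (fun t : ℝ => x + t * c) c t := by
      simpa using ((hasDerivAt_id t).mul_const c).const_add x
    have h2 := ((hg.integral_hasStrictDerivAt 0 (x + t * c)).hasDerivAt.comp t h1).div_const c
    rwa [mul_div_cancel_right₀ _ hc] at h2
  have hint' : Integrable (fun t : ℝ => g (x + t * c)) :=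
    (hint.comp_add_left x).comp_mul_right' hc
  rw [integral_Ioi_of_hasDerivAt_of_tendsto' (fun t _ => hderiv t) hint'.integrableOn
    ((hK x).div_const c)]
  simp only [zero_mul, add_zero]
  ring

/-- A compactly supported function that is multiplied by a fixed factor under a nonzero
translation vanishes. -/
theorem eq_zero_of_eq_mul_translate {g : ℝ → ℝ} (hs : HasCompactSupport g) {c d : ℝ} (hd : 0 < d)
    (h : ∀ x, g x = c * g (x + d)) (x : ℝ) : g x = 0 := by
  have hiter : ∀ m : ℕ, g x = c ^ m * g (x + m * d) := by
    intro m
    induction m with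
    | zero => simp
    | succ k ih =>
      rw [ih, h (x + k * d), pow_succ, mul_assoc]
      push_cast
      ring_nf
  obtain ⟨B, hB⟩ := hs.isCompact.bddAbove
  obtain ⟨m, hm⟩ := exists_nat_gt ((B - x) / d)
  rw [div_lt_iff₀ hd] at hm
  have hz : g (x + m * d) = 0 := by
    by_contra hne
    have := hB (subset_tsupport g hne)
    linarith
  rw [hiter m, hz, mul_zero]

/-- Unique determination from partial data: vanishing of the head wave transform
    at a single positive gliding length d₀ forces a compactly supported
    depth-independent function to vanish. -/
theorem stmt_5
    (u1 u2 v1 v2 : ℝ)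
    (hu_unit : u1 ^ 2 + u2 ^ 2 = 1) (hv_unit : v1 ^ 2 + v2 ^ 2 = 1)
    (hu1_neg : u1 < 0) (hu2_pos : 0 < u2)
    (hv1_pos : 0 < v1) (hv2_pos : 0 < v2)
    (ftil : ℝ → ℝ) (hftil_smooth : ContDiff ℝ (⊤ : ℕ∞) ftil)
    (hftil_supp : HasCompactSupport ftil)
    (f : ℝ × ℝ → ℝ) (hf : ∀ x y : ℝ, 0 ≤ y → f (x, y) = ftil x)
    (R : ℝ → ℝ → ℝ)
    (hR : ∀ x d, R x d =
      (∫ t in Ioi (0:ℝ), f ((x, 0) + t • (u1, u2)))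
      + (∫ t in (0:ℝ)..d, f (x + t, 0))
      + ∫ t in Ioi (0:ℝ), f ((x + d, 0) + t • (v1, v2)))
    (d₀ : ℝ) (hd₀ : 0 < d₀)
    (hvanish : ∀ x : ℝ, R x d₀ = 0) :
    ∀ x : ℝ, ftil x = 0 := by
  have hcont : Continuous ftil := hftil_smooth.continuous
  obtain ⟨A, hA⟩ := exists_integral_Ioi_ray_eq hcont hftil_supp hu1_neg.ne
  obtain ⟨B, hB⟩ := exists_integral_Ioi_ray_eq hcont hftil_supp hv1_pos.ne'
  set F : ℝ → ℝ := fun x => ∫ s in (0:ℝ)..x, ftil s with hF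
  have hF' : ∀ x, HasDerivAt F (ftil x) x := fun x =>
    (hcont.integral_hasStrictDerivAt 0 x).hasDerivAt
  have hsum : ∀ x, (A - F x) / u1 + (F (x + d₀) - F x) + (B - F (x + d₀)) / v1 = 0 := by
    intro x
    have e1 : ∫ t in Ioi (0:ℝ), f ((x, 0) + t • (u1, u2)) = (A - F x) / u1 := by
      rw [← hA x]
      refine setIntegral_congr_fun measurableSet_Ioi fun t ht => ?_
      exact hf _ _ (by simpa using (mul_pos ht hu2_pos).le)
    have e2 : ∫ t in (0:ℝ)..d₀, f (x + t, 0) = F (x + d₀) - F x := by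
      simp only [hf _ 0 le_rfl, hF]
      rw [intervalIntegral.integral_comp_add_left ftil x, add_zero,
        intervalIntegral.integral_interval_sub_left (hcont.intervalIntegrable _ _)
          (hcont.intervalIntegrable _ _)]
    have e3 : ∫ t in Ioi (0:ℝ), f ((x + d₀, 0) + t • (v1, v2)) = (B - F (x + d₀)) / v1 := by
      rw [← hB (x + d₀)]
      refine setIntegral_congr_fun measurableSet_Ioi fun t ht => ?_
      exact hf _ _ (by simpa using (mul_pos ht hv2_pos).le)
    rw [← e1, ← e2, ← e3, ← hR, hvanish]
  have hrel : ∀ x, -ftil x / u1 + (ftil (x + d₀) - ftil x) + -ftil (x + d₀) / v1 = 0 := by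
    intro x
    have hFd : HasDerivAt (fun y => F (y + d₀)) (ftil (x + d₀)) x :=
      (hF' (x + d₀)).comp_add_const x d₀
    have hd := ((((hF' x).const_sub A).div_const u1).add (hFd.sub (hF' x))).add
      ((hFd.const_sub B).div_const v1)
    exact hd.unique ((hasDerivAt_const x (0:ℝ)).congr_of_eventuallyEq
      (Filter.Eventually.of_forall hsum))
  have hu : u1 + 1 ≠ 0 := by nlinarith
  refine eq_zero_of_eq_mul_translate hftil_supp hd₀
    (c := u1 * (v1 - 1) / (v1 * (u1 + 1))) fun x => ?_
  have hx := hrel x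
  have hu1 := hu1_neg.ne
  have hv1 := hv1_pos.ne'
  field_simp at hx ⊢
  linarith
end

section
/- Let u = (u₁,u₂) ∈ ℝ² be a constant unit vector with u₂ > 0, and let f be a smooth compactly supported function on ℝ²₊ such that ∫₀^∞ f((x,0) + t·u) dt = 0 for all x ∈ ℝ. Define ψ(x,y) = ∫₀^{y/u₂} f((x − (u₁/u₂)y, 0) + t·u) dt for (x,y) ∈ ℝ²₊. Then ψ is smooth on ℝ²₊, ψ(x,0) = 0 for all x ∈ ℝ, ψ has compact support, and ∇_u ψ(x,y) = f(x,y) for all (x,y) ∈ ℝ²₊. -/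
open MeasureTheory Set

/-- A function of one variable supported in `[0, ∞)` has the same integral over `(0, r)`
and over `(-∞, r]`. -/
lemma intervalIntegral_zero_eq_integral_Iic {g : ℝ → ℝ} (hg : Integrable g)
    (hneg : ∀ t < 0, g t = 0) (r : ℝ) :
    ∫ t in (0:ℝ)..r, g t = ∫ t in Iic r, g t := by
  have hzero : ∫ t in Iic (0:ℝ), g t = 0 := by
    rw [integral_Iic_eq_integral_Iio]
    exact setIntegral_eq_zero_of_forall_eq_zero hneg
  rw [← intervalIntegral.integral_Iic_sub_Iic hg.integrableOn hg.integrableOn, hzero, sub_zero]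

/-- The primitive, in the second variable, of a smooth function of two variables which is
supported in a strip `ℝ × [0, T]` is jointly smooth. -/
lemma contDiff_primitive_of_support_strip {g : ℝ × ℝ → ℝ} {n : ℕ∞} (hg : ContDiff ℝ n g) {T : ℝ}
    (hneg : ∀ s, ∀ t < 0, g (s, t) = 0) (hpos : ∀ s, ∀ t, T < t → g (s, t) = 0) :
    ContDiff ℝ n fun p : ℝ × ℝ => ∫ t in (0:ℝ)..p.2, g (p.1, t) := by
  have hk : ∀ s t, t ∉ Icc 0 T → g (s, t) = 0 := by
    intro s t ht
    rcases lt_or_ge t 0 with h | h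
    · exact hneg s t h
    · exact hpos s t (lt_of_not_ge fun h' => ht ⟨h, h'⟩)
  have hloc : LocallyIntegrable ((Ici (0:ℝ)).indicator fun _ => (1:ℝ)) :=
    (locallyIntegrable_const 1).indicator measurableSet_Ici
  have hconv := contDiffOn_convolution_right_with_param (μ := volume)
    (ContinuousLinearMap.lsmul ℝ ℝ) (s := (univ : Set ℝ)) (g := fun s t => g (s, t)) isOpen_univ
    isCompact_Icc (fun s t _ => hk s t) hloc (n := n) (by exact hg.contDiffOn)
  rw [univ_prod_univ, contDiffOn_univ] at hconv
  convert hconv using 1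
  ext ⟨s, r⟩
  have hint : Integrable fun t => g (s, t) :=
    (hg.continuous.comp (by fun_prop)).integrable_of_hasCompactSupport
      (HasCompactSupport.intro isCompact_Icc (hk s))
  rw [convolution_lsmul_swap, intervalIntegral_zero_eq_integral_Iic hint (hneg s),
    ← integral_indicator measurableSet_Iic]
  refine integral_congr_ae (.of_forall fun t => ?_)
  by_cases h : t ≤ r <;> simp [indicator, h]

/-- Construction of a potential for a beam direction: if all beam integrals of f in
    direction u vanish, then ψ(x,y) = ∫₀^{y/u₂} f((x − (u₁/u₂)y, 0) + t·u) dt is a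
    smooth compactly supported potential with ∇_u ψ = f on the upper half-plane. -/
theorem stmt_8
    (u1 u2 : ℝ)
    (hu_unit : u1 ^ 2 + u2 ^ 2 = 1) (hu2_pos : 0 < u2)
    (f : ℝ × ℝ → ℝ) (hf_smooth : ContDiff ℝ (⊤ : ℕ∞) f)
    (hf_supp : HasCompactSupport f)
    (hf_half : tsupport f ⊆ {p : ℝ × ℝ | 0 ≤ p.2})
    (hbeam : ∀ x : ℝ, (∫ t in Ioi (0:ℝ), f ((x, 0) + t • (u1, u2))) = 0)
    (ψ : ℝ × ℝ → ℝ)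
    (hψ : ∀ x y : ℝ, ψ (x, y) =
      ∫ t in (0:ℝ)..(y / u2), f ((x - (u1 / u2) * y, 0) + t • (u1, u2))) :
    ContDiffOn ℝ (⊤ : ℕ∞) ψ {p : ℝ × ℝ | 0 ≤ p.2} ∧
    (∀ x : ℝ, ψ (x, 0) = 0) ∧
    HasCompactSupport ψ ∧
    (∀ x y : ℝ, 0 ≤ y → fderiv ℝ ψ (x, y) (u1, u2) = f (x, y)) := by
  obtain ⟨R, hR⟩ := hf_supp.isCompact.isBounded.subset_closedBall 0
  have hbd : ∀ a b : ℝ, f (a, b) ≠ 0 → 0 ≤ b ∧ |a| ≤ R ∧ |b| ≤ R := by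
    intro a b h
    have hmem := subset_tsupport f (Function.mem_support.2 h)
    have hnorm : ‖((a, b) : ℝ × ℝ)‖ ≤ R := mem_closedBall_zero_iff.1 (hR hmem)
    rw [Prod.norm_def, max_le_iff] at hnorm
    exact ⟨hf_half hmem, hnorm⟩
  have hu2 : u2 ≠ 0 := hu2_pos.ne'
  set g : ℝ × ℝ → ℝ := fun p => f ((p.1, 0) + p.2 • (u1, u2)) with hg_def
  have hg_apply : ∀ s t, g (s, t) = f (s + t * u1, t * u2) := by
    intro s t
    simp [hg_def]
  have hg_smooth : ContDiff ℝ (⊤ : ℕ∞) g := by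
    refine hf_smooth.comp ?_
    fun_prop
  have hneg : ∀ s, ∀ t < 0, g (s, t) = 0 := by
    intro s t ht
    by_contra h
    rw [hg_apply] at h
    exact (mul_neg_of_neg_of_pos ht hu2_pos).not_ge (hbd _ _ h).1
  have hpos : ∀ s, ∀ t, R / u2 < t → g (s, t) = 0 := by
    intro s t ht
    by_contra h
    rw [hg_apply] at h
    exact ((div_lt_iff₀ hu2_pos).1 ht).not_ge ((le_abs_self _).trans (hbd _ _ h).2.2)
  have hψ_eq : ψ = fun p : ℝ × ℝ =>
      ∫ t in (0:ℝ)..(p.2 / u2), g (p.1 - (u1 / u2) * p.2, t) := by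
    ext ⟨x, y⟩
    exact hψ x y
  have hψ_smooth : ContDiff ℝ (⊤ : ℕ∞) ψ := by
    rw [hψ_eq]
    exact (contDiff_primitive_of_support_strip hg_smooth hneg hpos).comp
      (f := fun p : ℝ × ℝ => (p.1 - (u1 / u2) * p.2, p.2 / u2)) (by fun_prop)
  refine ⟨hψ_smooth.contDiffOn, fun x => by simp [hψ], ?_, fun x y _ => ?_⟩
  · set M := R + R / u2 * |u1| with hM
    refine HasCompactSupport.intro
      (K := Icc (-(M + |u1 / u2| * R)) (M + |u1 / u2| * R) ×ˢ Icc 0 R)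
      (isCompact_Icc.prod isCompact_Icc) ?_
    rintro ⟨x, y⟩ hxy
    contrapose! hxy
    have hψ_ne : ∫ t in (0:ℝ)..(y / u2), g (x - (u1 / u2) * y, t) ≠ 0 := by
      rwa [← hψ x y]
    obtain ⟨t, ht⟩ : ∃ t ∈ uIcc 0 (y / u2), g (x - (u1 / u2) * y, t) ≠ 0 := by
      by_contra! h
      exact hψ_ne ((intervalIntegral.integral_congr h).trans intervalIntegral.integral_zero)
    obtain ⟨ht_mem, ht_ne⟩ := ht
    have ht0 : 0 ≤ t := le_of_not_gt fun h => ht_ne (hneg _ _ h)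
    have htR : t ≤ R / u2 := le_of_not_gt fun h => ht_ne (hpos _ _ h)
    have hyR : y ≤ R := by
      by_contra! h
      refine hψ_ne ?_
      have hR0 : 0 ≤ R / u2 := ht0.trans htR
      have hy : R / u2 < y / u2 := by gcongr
      rw [intervalIntegral.integral_of_le (hR0.trans hy.le)]
      refine Eq.trans ?_ (hbeam (x - (u1 / u2) * y))
      refine (setIntegral_eq_of_subset_of_forall_sdiff_eq_zero (t := Ioi (0:ℝ))
        (f := fun t => g (x - (u1 / u2) * y, t)) measurableSet_Ioi
        Ioc_subset_Ioi_self fun t ht => ?_).symm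
      exact hpos _ t (hy.trans (lt_of_not_ge fun h' => ht.2 ⟨ht.1, h'⟩))
    have hy0 : 0 ≤ y := by
      by_contra! h
      refine hψ_ne ?_
      have hy : y / u2 < 0 := div_neg_of_neg_of_pos h hu2_pos
      rw [intervalIntegral.integral_of_ge hy.le, integral_Ioc_eq_integral_Ioo,
        setIntegral_eq_zero_of_forall_eq_zero fun t ht => hneg _ t ht.2, neg_zero]
    rw [hg_apply] at ht_ne
    have hs := (hbd _ _ ht_ne).2.1
    have htu : |t * u1| ≤ R / u2 * |u1| := by
      rw [abs_mul, abs_of_nonneg ht0]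
      gcongr
    have hyu : |u1 / u2 * y| ≤ |u1 / u2| * R := by
      rw [abs_mul, abs_of_nonneg hy0]
      gcongr
    rw [abs_le] at hs htu hyu
    exact ⟨⟨by linarith, by linarith⟩, hy0, hyR⟩
  · rw [← ((hψ_smooth.differentiable (by simp)) (x, y)).lineDeriv_eq_fderiv]
    have hline : ∀ r : ℝ, ψ ((x, y) + r • (u1, u2)) =
        ∫ t in (0:ℝ)..(y / u2 + r), g (x - (u1 / u2) * y, t) := by
      intro r
      have h1 : x + r * u1 - u1 / u2 * (y + r * u2) = x - u1 / u2 * y := by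
        field_simp
        ring
      have h2 : (y + r * u2) / u2 = y / u2 + r := by
        field_simp
      simp [hψ_eq, h1, h2]
    have hcont : Continuous fun t => g (x - (u1 / u2) * y, t) :=
      hg_smooth.continuous.comp (by fun_prop)
    have hderiv := (hcont.integral_hasStrictDerivAt 0 (y / u2 + 0)).hasDerivAt.comp_const_add
      (y / u2) 0
    rw [lineDeriv, funext hline, hderiv.deriv, hg_apply]
    congr 2 <;> field_simp <;> ring
end

section
/- Let u = (u₁,u₂), v = (v₁,v₂) : ℝ² → ℝ² be smooth unit vector fields that are linearly independent at every point, whose integral curves are straight lines (i.e. u(p + t·u(p)) = u(p) and v(p + t·v(p)) = v(p) for all p ∈ ℝ² and t ∈ ℝ), and which satisfy u₁ < 0, u₂ > 0, v₁ > 0, v₂ > 0 on ℝ × {0}. Let f ∈ C_c^∞(ℝ²) with supp f ⊆ {(x,y) : y > 0}, and assume div(u)(p)·∫₀^∞ f(p + t·u(p)) dt = div(v)(p)·∫₀^∞ f(p + t·v(p)) dt for all p ∈ ℝ²₊. Then the following are equivalent: (1) Rf(x,d) = 0 for all x ∈ ℝ and d ≥ 0; (2) there exists φ ∈ C_c^∞(ℝ²₊)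 vanishing on ℝ × {0} such that f(p) = P_u(p)[det(A_{u,v}(p))^{−1}·P_v(p)φ(p)] and f(p) = P_v(p)[det(A_{u,v}(p))^{−1}·P_u(p)φ(p)] for all p ∈ ℝ²₊. -/
open MeasureTheory Set

section RayIntegral

variable {E : Type*} [NormedAddCommGroup E] [NormedSpace ℝ E]

/-- The integral of `f` over the ray issuing from `p` in the direction `-a`. -/
noncomputable def rayIntegral (a : E) (f : E → ℝ) (p : E) : ℝ :=
  ∫ s in Ioi (0 : ℝ), f (p - s • a)

lemma isClosedEmbedding_sub_smul {a : E} (ha : a ≠ 0) (p : E) :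
    Topology.IsClosedEmbedding fun s : ℝ => p - s • a :=
  (Homeomorph.subLeft p).isClosedEmbedding.comp (isClosedEmbedding_smul_left ha)

lemma HasCompactSupport.comp_sub_smul {f : E → ℝ} (hf : HasCompactSupport f) {a : E}
    (ha : a ≠ 0) (p : E) : HasCompactSupport fun s : ℝ => f (p - s • a) :=
  hf.comp_isClosedEmbedding (isClosedEmbedding_sub_smul ha p)

lemma HasCompactSupport.integrable_comp_sub_smul {f : E → ℝ} (hf : HasCompactSupport f)
    (hc : Continuous f) {a : E} (ha : a ≠ 0) (p : E) :
    Integrable fun s : ℝ => f (p - s • a) :=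
  (hc.comp (isClosedEmbedding_sub_smul ha p).continuous).integrable_of_hasCompactSupport
    (hf.comp_sub_smul ha p)

lemma contDiff_rayIntegral [FiniteDimensional ℝ E] {n : ℕ∞} {f : E → ℝ} (hf : ContDiff ℝ n f)
    (hfc : HasCompactSupport f) {a : E} (ha : a ≠ 0) : ContDiff ℝ n (rayIntegral a f) := by
  borelize E
  have hcl : Topology.IsClosedEmbedding fun s : ℝ => s • a := isClosedEmbedding_smul_left ha
  let μ : Measure E := (volume.restrict (Ioi (0 : ℝ))).map fun s : ℝ => s • a
  have : IsFiniteMeasureOnCompacts μ := by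
    refine ⟨fun K hK => ?_⟩
    rw [hcl.measurableEmbedding.map_apply]
    exact (hcl.isCompact_preimage hK).measure_lt_top
  have h := hfc.contDiff_convolution_right (ContinuousLinearMap.mul ℝ ℝ) (μ := μ)
    (f := fun _ => (1 : ℝ)) (locallyIntegrable_const 1) hf
  have heq : rayIntegral a f
      = convolution (fun _ => (1 : ℝ)) f (ContinuousLinearMap.mul ℝ ℝ) μ := by
    funext p
    simp only [rayIntegral, convolution, μ, hcl.measurableEmbedding.integral_map,
      ContinuousLinearMap.mul_apply', one_mul]
  rw [heq]
  exact h

lemma fderiv_rayIntegral_apply [FiniteDimensional ℝ E] {f : E → ℝ} (hf : ContDiff ℝ 1 f)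
    (hfc : HasCompactSupport f) {a : E} (ha : a ≠ 0) (p : E) :
    fderiv ℝ (rayIntegral a f) p a = f p := by
  have hd : DifferentiableAt ℝ (rayIntegral a f) p :=
    (contDiff_rayIntegral (n := 1) hf hfc ha).differentiable one_ne_zero p
  have hline : HasDerivAt (fun r : ℝ => p + r • a) a 0 := by
    simpa using ((hasDerivAt_id (0 : ℝ)).smul_const a).const_add p
  have h1 : HasDerivAt (fun r : ℝ => rayIntegral a f (p + r • a))
      (fderiv ℝ (rayIntegral a f) p a) 0 := by
    have h : HasFDerivAt (rayIntegral a f) (fderiv ℝ (rayIntegral a f) p) (p + (0 : ℝ) • a) := by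
      simpa using hd.hasFDerivAt
    exact h.comp_hasDerivAt (0 : ℝ) hline
  let g : ℝ → ℝ := fun t => f (p + t • a)
  have hg : Continuous g := hf.continuous.comp (by fun_prop)
  have hgi : Integrable g := by
    have h := hfc.integrable_comp_sub_smul hf.continuous (neg_ne_zero.2 ha) p
    simpa [g, smul_neg, sub_neg_eq_add] using h
  have hrw : (fun r : ℝ => rayIntegral a f (p + r • a))
      = fun r => (∫ t in Iic (0 : ℝ), g t) + ∫ t in (0 : ℝ)..r, g t := by
    funext r
    have h2 := (Measure.measurePreserving_sub_left (volume : Measure ℝ) r).setIntegral_preimage_emb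
      (MeasurableEquiv.subLeft r).measurableEmbedding g (Iio r)
    have hpre : (fun s : ℝ => r - s) ⁻¹' Iio r = Ioi 0 := by
      ext s
      simp
    rw [← intervalIntegral.integral_Iic_sub_Iic hgi.integrableOn hgi.integrableOn,
      add_sub_cancel, integral_Iic_eq_integral_Iio, ← h2, hpre]
    simp only [rayIntegral, g]
    congr 1 with s
    congr 1
    module
  have h3 : HasDerivAt (fun r : ℝ => rayIntegral a f (p + r • a)) (g 0) 0 := by
    rw [hrw]
    exact (intervalIntegral.integral_hasDerivAt_right (hg.intervalIntegrable _ _)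
      (hg.stronglyMeasurableAtFilter _ _) hg.continuousAt).const_add _
  simpa [g] using h1.unique h3

lemma hasCompactSupport_rayIntegral [FiniteDimensional ℝ E] {f : E → ℝ} (hf : Continuous f)
    (hfc : HasCompactSupport f) {a : E} (ha : a ≠ 0)
    (h0 : ∀ p, ∫ s : ℝ, f (p - s • a) = 0) : HasCompactSupport (rayIntegral a f) := by
  obtain ⟨K, hK⟩ := hfc.isCompact.isBounded.exists_norm_le
  refine HasCompactSupport.of_support_subset_isCompact (isCompact_closedBall (0 : E) (3 * K)) ?_
  intro p hp
  have hi := hfc.integrable_comp_sub_smul hf ha p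
  have hsplit : (∫ s in Iic (0 : ℝ), f (p - s • a)) + rayIntegral a f p = 0 := by
    rw [rayIntegral, intervalIntegral.integral_Iic_add_Ioi hi.integrableOn hi.integrableOn, h0]
  have hex1 : ∃ s : ℝ, 0 < s ∧ f (p - s • a) ≠ 0 := by
    by_contra! h
    exact hp (setIntegral_eq_zero_of_forall_eq_zero fun s hs => h s hs)
  have hex2 : ∃ s : ℝ, s ≤ 0 ∧ f (p - s • a) ≠ 0 := by
    by_contra! h
    have hz : ∫ s in Iic (0 : ℝ), f (p - s • a) = 0 :=
      setIntegral_eq_zero_of_forall_eq_zero fun s hs => h s hs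
    rw [hz, zero_add] at hsplit
    exact hp hsplit
  obtain ⟨s, hs, hfs⟩ := hex1
  obtain ⟨t, ht, hft⟩ := hex2
  have hns := hK _ (subset_tsupport _ hfs)
  have hnt := hK _ (subset_tsupport _ hft)
  have h1 : (s - t) * ‖a‖ ≤ 2 * K := by
    calc (s - t) * ‖a‖ = ‖(p - t • a) - (p - s • a)‖ := by
          rw [show (p - t • a) - (p - s • a) = (s - t) • a by module, norm_smul,
            Real.norm_of_nonneg (by linarith)]
      _ ≤ 2 * K := by linarith [norm_sub_le (p - t • a) (p - s • a)]
  have h2 : ‖p‖ ≤ ‖p - s • a‖ + s * ‖a‖ := by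
    calc ‖p‖ = ‖(p - s • a) + s • a‖ := by rw [sub_add_cancel]
      _ ≤ _ := by
        refine (norm_add_le _ _).trans ?_
        rw [norm_smul, Real.norm_of_nonneg hs.le]
  have h3 : t * ‖a‖ ≤ 0 := mul_nonpos_of_nonpos_of_nonneg ht (norm_nonneg a)
  rw [mem_closedBall_zero_iff]
  linarith

lemma integral_rayIntegral_eq_zero {f : E → ℝ} (hf : Continuous f) (hfc : HasCompactSupport f)
    {a b : E} (hab : ∀ s t : ℝ, s • a + t • b = 0 → s = 0 ∧ t = 0)
    (h0 : ∀ p, ∫ t : ℝ, f (p - t • b) = 0) (p : E) :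
    ∫ t : ℝ, rayIntegral a f (p - t • b) = 0 := by
  let L : ℝ × ℝ →ₗ[ℝ] E :=
    (LinearMap.fst ℝ ℝ ℝ).smulRight b + (LinearMap.snd ℝ ℝ ℝ).smulRight a
  have hL : Topology.IsClosedEmbedding L := by
    refine LinearMap.isClosedEmbedding_of_injective (LinearMap.ker_eq_bot'.2 ?_)
    rintro ⟨t, s⟩ h
    obtain ⟨hs, ht⟩ := hab s t (by simpa [L, add_comm] using h)
    simp [hs, ht]
  have hcl : Topology.IsClosedEmbedding fun z : ℝ × ℝ => p - L z :=
    (Homeomorph.subLeft p).isClosedEmbedding.comp hL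
  have heq : (Function.uncurry fun t s : ℝ => f (p - t • b - s • a))
      = f ∘ fun z : ℝ × ℝ => p - L z := by
    funext z
    simp [L, Function.uncurry, sub_sub]
  simp only [rayIntegral]
  rw [integral_integral_swap_of_hasCompactSupport (f := fun t s : ℝ => f (p - t • b - s • a))
    (heq ▸ hf.comp hcl.continuous) (heq ▸ hfc.comp_isClosedEmbedding hcl)]
  refine setIntegral_eq_zero_of_forall_eq_zero fun s _ => ?_
  rw [← h0 (p - s • a)]
  congr 1 with t
  rw [sub_right_comm]

end RayIntegral

lemma fderiv_fderiv_apply_comm {E F : Type*} [NormedAddCommGroup E] [NormedSpace ℝ E]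
    [NormedAddCommGroup F] [NormedSpace ℝ F] {φ : E → F} (hφ : ContDiff ℝ 2 φ) (a b p : E) :
    fderiv ℝ (fun q => fderiv ℝ φ q a) p b = fderiv ℝ (fun q => fderiv ℝ φ q b) p a := by
  have hd : DifferentiableAt ℝ (fderiv ℝ φ) p :=
    (hφ.fderiv_right (m := 1) (by norm_num)).differentiable one_ne_zero p
  have happ : ∀ c d : E, fderiv ℝ (fun q => fderiv ℝ φ q c) p d = fderiv ℝ (fderiv ℝ φ) p d c := by
    intro c d
    rw [fderiv_clm_apply hd (differentiableAt_const c)]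
    simp
  rw [happ, happ]
  exact (hφ.contDiffAt.isSymmSndFDerivAt (by simp)).eq b a

/-- Disjoint lines in the plane are parallel, so a unit field constant along its own lines
is constant as soon as its components have fixed signs on the horizontal axis. -/
lemma eq_const_of_straight_lines {w : ℝ × ℝ → ℝ × ℝ} (hunit : ∀ p, (w p).1 ^ 2 + (w p).2 ^ 2 = 1)
    (hlines : ∀ (p : ℝ × ℝ) (t : ℝ), w (p + t • w p) = w p) (hpos : ∀ x : ℝ, 0 < (w (x, 0)).2)
    (p : ℝ × ℝ) : w p = w (0, 0) := by
  have hpar : ∀ p q, (w p).1 * (w q).2 - (w p).2 * (w q).1 = 0 := by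
    intro p q
    by_contra hne
    set D := (w p).1 * (w q).2 - (w p).2 * (w q).1 with hD
    set s := ((q.1 - p.1) * (w q).2 - (q.2 - p.2) * (w q).1) / D with hs
    set t := ((q.1 - p.1) * (w p).2 - (q.2 - p.2) * (w p).1) / D with ht
    have hmeet : p + s • w p = q + t • w q := by
      ext
      · simp only [Prod.fst_add, Prod.smul_fst, smul_eq_mul, hs, ht]
        field_simp
        rw [hD]; ring
      · simp only [Prod.snd_add, Prod.smul_snd, smul_eq_mul, hs, ht]
        field_simp
        rw [hD]; ring
    have heq : w p = w q := by rw [← hlines p s, hmeet, hlines q t]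
    apply hne
    rw [hD, heq]; ring
  have haxis : ∀ q, 0 < (w q).2 → w q = w (0, 0) := by
    intro q hq
    have h1 := hunit q
    have h2 := hunit (0, 0)
    have h3 := hpar q (0, 0)
    have h4 := hpos 0
    have h5 : (w q).2 = (w (0, 0)).2 := by
      have : (w q).2 ^ 2 = (w (0, 0)).2 ^ 2 := by
        linear_combination (w (0, 0)).2 ^ 2 * h1 - (w q).2 ^ 2 * h2
          - ((w q).1 * (w (0, 0)).2 + (w q).2 * (w (0, 0)).1) * h3
      exact (sq_eq_sq₀ hq.le h4.le).1 this
    have h6 : (w q).1 = (w (0, 0)).1 := by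
      rw [h5] at h3
      have : (w (0, 0)).2 * ((w q).1 - (w (0, 0)).1) = 0 := by linear_combination h3
      rcases mul_eq_zero.1 this with h | h
      · exact absurd h h4.ne'
      · linarith
    exact Prod.ext h6 h5
  have hp2 : (w p).2 ≠ 0 := by
    intro h
    have h1 := hpar p (0, 0)
    have h2 := hunit p
    rw [h] at h1 h2
    have h3 : (w p).1 * (w (0, 0)).2 = 0 := by linarith
    rcases mul_eq_zero.1 h3 with h4 | h4
    · rw [h4] at h2; norm_num at h2
    · exact absurd h4 (hpos 0).ne'
  have hfoot : p + (-p.2 / (w p).2) • w p = (p.1 - p.2 / (w p).2 * (w p).1, 0) := by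
    ext
    · simp; ring
    · simp; field_simp; ring
  have hw := hlines p (-p.2 / (w p).2)
  rw [hfoot] at hw
  rw [← hw]
  exact haxis _ (hpos _)

lemma rayIntegral_eq_zero_of_nonpos {f : ℝ × ℝ → ℝ} (hf : ∀ p : ℝ × ℝ, p.2 ≤ 0 → f p = 0)
    {a : ℝ × ℝ} (ha : 0 < a.2) {p : ℝ × ℝ} (hp : p.2 ≤ 0) : rayIntegral a f p = 0 := by
  refine setIntegral_eq_zero_of_forall_eq_zero fun s hs => hf _ ?_
  have : 0 < s * a.2 := mul_pos hs ha
  simp only [Prod.snd_sub, Prod.smul_snd, smul_eq_mul]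
  linarith

lemma integral_line_eq_zero {f : ℝ × ℝ → ℝ} (hfc : Continuous f) (hfs : HasCompactSupport f)
    (hf : ∀ p : ℝ × ℝ, p.2 ≤ 0 → f p = 0) {a : ℝ × ℝ} (ha : 0 < a.2)
    (h0 : ∀ x : ℝ, ∫ t in Ioi (0 : ℝ), f ((x, 0) + t • a) = 0) (p : ℝ × ℝ) :
    ∫ s : ℝ, f (p - s • a) = 0 := by
  have ha0 : a ≠ 0 := fun h => by simp [h] at ha
  let x : ℝ := p.1 - p.2 / a.2 * a.1
  have hcov : ∀ s : ℝ, f (p - s • a) = (fun t : ℝ => f ((x, 0) + t • a)) (p.2 / a.2 - s) := by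
    intro s
    simp only
    congr 1
    ext
    · simp [x]; ring
    · simp; field_simp
  simp_rw [hcov]
  rw [integral_sub_left_eq_self (fun t : ℝ => f ((x, 0) + t • a))]
  have hi : Integrable fun t : ℝ => f ((x, 0) + t • a) := by
    simpa [smul_neg, sub_neg_eq_add] using
      hfs.integrable_comp_sub_smul hfc (neg_ne_zero.2 ha0) (x, 0)
  rw [← intervalIntegral.integral_Iic_add_Ioi (b := 0) hi.integrableOn hi.integrableOn, h0, add_zero]
  refine setIntegral_eq_zero_of_forall_eq_zero fun t ht => hf _ ?_
  simpa using mul_nonpos_of_nonpos_of_nonneg ht ha.le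

lemma integral_ray_eq_neg {g : ℝ × ℝ → ℝ} (hg : ContDiff ℝ 1 g) (hgc : HasCompactSupport g)
    {a : ℝ × ℝ} (ha : a ≠ 0) (p : ℝ × ℝ) :
    ∫ t in Ioi (0 : ℝ), fderiv ℝ g (p + t • a) a = - g p := by
  have hc : HasCompactSupport fun t : ℝ => g (p + t • a) := by
    simpa [smul_neg, sub_neg_eq_add] using hgc.comp_sub_smul (neg_ne_zero.2 ha) p
  have hd : ∀ t : ℝ, deriv (fun t : ℝ => g (p + t • a)) t = fderiv ℝ g (p + t • a) a := by
    intro t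
    have hline : HasDerivAt (fun r : ℝ => p + r • a) a t := by
      simpa using ((hasDerivAt_id t).smul_const a).const_add p
    exact ((hg.differentiable one_ne_zero _).hasFDerivAt.comp_hasDerivAt t hline).deriv
  have hcd : ContDiff ℝ 1 fun t : ℝ => g (p + t • a) := hg.comp (by fun_prop)
  have h := hc.integral_Ioi_deriv_eq hcd 0
  simpa [hd] using h

lemma fderiv_eq_zero_of_tsupport_subset {φ : ℝ × ℝ → ℝ} (hφ : ContDiff ℝ 1 φ)
    (hs : tsupport φ ⊆ {p : ℝ × ℝ | 0 ≤ p.2}) (x : ℝ) : fderiv ℝ φ (x, 0) = 0 := by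
  have hcont : Continuous fun y : ℝ => fderiv ℝ φ (x, y) :=
    (hφ.continuous_fderiv one_ne_zero).comp (by fun_prop)
  have hzero : ∀ y ∈ Iio (0 : ℝ), fderiv ℝ φ (x, y) = 0 := by
    intro y hy
    by_contra h
    have hmem := hs (support_fderiv_subset ℝ h)
    exact not_lt.2 hmem (mem_Iio.1 hy)
  have hclosed : IsClosed {y : ℝ | fderiv ℝ φ (x, y) = 0} := isClosed_eq hcont continuous_const
  have hsub : closure (Iio (0 : ℝ)) ⊆ {y : ℝ | fderiv ℝ φ (x, y) = 0} :=
    closure_minimal hzero hclosed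
  rw [closure_Iio] at hsub
  exact hsub self_mem_Iic


open MeasureTheory Set

/-- General gauge (kernel) description in the plane for variable direction fields
    whose integral curves are straight lines. -/
theorem stmt_10
    (u v : ℝ × ℝ → ℝ × ℝ)
    (hu_smooth : ContDiff ℝ (⊤ : ℕ∞) u) (hv_smooth : ContDiff ℝ (⊤ : ℕ∞) v)
    (hu_unit : ∀ p, (u p).1 ^ 2 + (u p).2 ^ 2 = 1)
    (hv_unit : ∀ p, (v p).1 ^ 2 + (v p).2 ^ 2 = 1)
    (hindep : ∀ p, (u p).1 * (v p).2 - (u p).2 * (v p).1 ≠ 0)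
    (hu_lines : ∀ (p : ℝ × ℝ) (t : ℝ), u (p + t • u p) = u p)
    (hv_lines : ∀ (p : ℝ × ℝ) (t : ℝ), v (p + t • v p) = v p)
    (hsigns : ∀ x : ℝ, (u (x, 0)).1 < 0 ∧ 0 < (u (x, 0)).2 ∧
      0 < (v (x, 0)).1 ∧ 0 < (v (x, 0)).2)
    (f : ℝ × ℝ → ℝ) (hf_smooth : ContDiff ℝ (⊤ : ℕ∞) f)
    (hf_supp : HasCompactSupport f)
    (hf_pos : Function.support f ⊆ {p : ℝ × ℝ | 0 < p.2})
    (hdiv : ∀ p : ℝ × ℝ, 0 ≤ p.2 →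
      (fderiv ℝ (fun q => (u q).1) p (1, 0) + fderiv ℝ (fun q => (u q).2) p (0, 1))
          * (∫ t in Ioi (0:ℝ), f (p + t • u p))
        = (fderiv ℝ (fun q => (v q).1) p (1, 0) + fderiv ℝ (fun q => (v q).2) p (0, 1))
          * ∫ t in Ioi (0:ℝ), f (p + t • v p))
    (R : ℝ → ℝ → ℝ)
    (hR : ∀ x d, R x d =
      (∫ t in Ioi (0:ℝ), f ((x, 0) + t • u (x, 0)))
      + (∫ t in (0:ℝ)..d, f (x + t, 0))
      + ∫ t in Ioi (0:ℝ), f ((x + d, 0) + t • v (x + d, 0))) :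
    (∀ x d : ℝ, 0 ≤ d → R x d = 0) ↔
      ∃ φ : ℝ × ℝ → ℝ, ContDiff ℝ (⊤ : ℕ∞) φ ∧ HasCompactSupport φ ∧
        tsupport φ ⊆ {p : ℝ × ℝ | 0 ≤ p.2} ∧ (∀ x : ℝ, φ (x, 0) = 0) ∧
        (∀ p : ℝ × ℝ, 0 ≤ p.2 →
          f p = fderiv ℝ
            (fun q => ((u q).1 * (v q).2 - (u q).2 * (v q).1)⁻¹ * fderiv ℝ φ q (v q))
            p (u p)) ∧
        (∀ p : ℝ × ℝ, 0 ≤ p.2 →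
          f p = fderiv ℝ
            (fun q => ((u q).1 * (v q).2 - (u q).2 * (v q).1)⁻¹ * fderiv ℝ φ q (u q))
            p (v p)) := by
  obtain ⟨a, rfl⟩ : ∃ a, u = fun _ => a :=
    ⟨u (0, 0), funext (eq_const_of_straight_lines hu_unit hu_lines fun x => (hsigns x).2.1)⟩
  obtain ⟨b, rfl⟩ : ∃ b, v = fun _ => b :=
    ⟨v (0, 0), funext (eq_const_of_straight_lines hv_unit hv_lines fun x => (hsigns x).2.2.2)⟩
  obtain ⟨ha1, ha2, hb1, hb2⟩ := hsigns 0
  replace hindep := hindep 0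
  simp only at hindep ha1 ha2 hb1 hb2 hR ⊢
  set D := a.1 * b.2 - a.2 * b.1 with hD
  have ha0 : a ≠ 0 := fun h => by simp [h] at ha2
  have hb0 : b ≠ 0 := fun h => by simp [h] at hb2
  have hf0 : ∀ p : ℝ × ℝ, p.2 ≤ 0 → f p = 0 := fun p hp => by
    by_contra h
    exact not_lt.2 hp (hf_pos h)
  have hR' : ∀ x d, R x d = (∫ t in Ioi (0:ℝ), f ((x, 0) + t • a))
      + ∫ t in Ioi (0:ℝ), f ((x + d, 0) + t • b) := fun x d => by
    have hmid : ∀ t : ℝ, f (x + t, 0) = 0 := fun t => hf0 _ le_rfl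
    simp [hR, hmid]
  constructor
  · intro h
    obtain ⟨K, hK⟩ := hf_supp.isCompact.isBounded.exists_norm_le
    have hfar : ∀ x : ℝ, x < -K → ∫ t in Ioi (0:ℝ), f ((x, 0) + t • a) = 0 := by
      intro x hx
      refine setIntegral_eq_zero_of_forall_eq_zero fun t ht => ?_
      by_contra hne
      have h1 := (norm_fst_le _).trans (hK _ (subset_tsupport _ hne))
      have h2 : t * a.1 < 0 := mul_neg_of_pos_of_neg ht ha1
      have h3 := (abs_le.1 h1).1
      simp only [Prod.fst_add, Prod.smul_fst, smul_eq_mul] at h3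
      linarith
    have hVb : ∀ y : ℝ, ∫ t in Ioi (0:ℝ), f ((y, 0) + t • b) = 0 := by
      intro y
      have hmin : min y (-K - 1) < -K := (min_le_right _ _).trans_lt (by linarith)
      have h1 := h (min y (-K - 1)) (y - min y (-K - 1)) (sub_nonneg.2 (min_le_left _ _))
      rwa [hR', hfar _ hmin, zero_add, add_sub_cancel] at h1
    have hUa : ∀ x : ℝ, ∫ t in Ioi (0:ℝ), f ((x, 0) + t • a) = 0 := by
      intro x
      have h1 := h x 0 le_rfl
      rwa [hR', hVb, add_zero] at h1
    have hLa := integral_line_eq_zero hf_smooth.continuous hf_supp hf0 ha2 hUa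
    have hLb := integral_line_eq_zero hf_smooth.continuous hf_supp hf0 hb2 hVb
    have hab : ∀ s t : ℝ, s • a + t • b = 0 → s = 0 ∧ t = 0 := by
      intro s t hst
      have e1 := congrArg Prod.fst hst
      have e2 := congrArg Prod.snd hst
      simp only [Prod.fst_add, Prod.snd_add, Prod.smul_fst, Prod.smul_snd, smul_eq_mul,
        Prod.fst_zero, Prod.snd_zero] at e1 e2
      have hs : s * D = 0 := by rw [hD]; linear_combination b.2 * e1 - b.1 * e2
      have ht : t * D = 0 := by rw [hD]; linear_combination a.1 * e2 - a.2 * e1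
      exact ⟨(mul_eq_zero.1 hs).resolve_right hindep, (mul_eq_zero.1 ht).resolve_right hindep⟩
    have hG := contDiff_rayIntegral hf_smooth hf_supp ha0
    have hGc := hasCompactSupport_rayIntegral hf_smooth.continuous hf_supp ha0 hLa
    have hG0 : ∀ p : ℝ × ℝ, p.2 ≤ 0 → rayIntegral a f p = 0 :=
      fun p hp => rayIntegral_eq_zero_of_nonpos hf0 ha2 hp
    have hΦ := contDiff_rayIntegral hG hGc hb0
    have hΦc := hasCompactSupport_rayIntegral hG.continuous hGc hb0
      (integral_rayIntegral_eq_zero hf_smooth.continuous hf_supp hab hLb)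
    have hΦ0 : ∀ p : ℝ × ℝ, p.2 ≤ 0 → rayIntegral b (rayIntegral a f) p = 0 :=
      fun p hp => rayIntegral_eq_zero_of_nonpos hG0 hb2 hp
    set Φ := rayIntegral b (rayIntegral a f) with hΦdef
    have hone : (1 : WithTop ℕ∞) ≤ ((⊤ : ℕ∞) : WithTop ℕ∞) := by exact_mod_cast le_top
    have htwo : (2 : WithTop ℕ∞) ≤ ((⊤ : ℕ∞) : WithTop ℕ∞) := WithTop.coe_le_coe.2 le_top
    have hφ : ContDiff ℝ (⊤ : ℕ∞) fun p => D * Φ p := contDiff_const.mul hΦ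
    have hder : ∀ q c, fderiv ℝ (fun p => D * Φ p) q c = D * fderiv ℝ Φ q c := by
      intro q c
      rw [fderiv_const_mul (hΦ.differentiable (by simp) q)]
      simp
    have hcancel : ∀ c, (fun q => D⁻¹ * fderiv ℝ (fun p => D * Φ p) q c)
        = fun q => fderiv ℝ Φ q c := by
      intro c
      funext q
      rw [hder, inv_mul_cancel_left₀ hindep]
    have hmixed : ∀ p, fderiv ℝ (fun q => fderiv ℝ Φ q b) p a = f p := by
      intro p
      have : (fun q => fderiv ℝ Φ q b) = rayIntegral a f :=
        funext fun q => fderiv_rayIntegral_apply (hG.of_le hone) hGc hb0 q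
      rw [this]
      exact fderiv_rayIntegral_apply (hf_smooth.of_le hone) hf_supp ha0 p
    refine ⟨fun p => D * Φ p, hφ, hΦc.mul_left, ?_, ?_, ?_, ?_⟩
    · refine closure_minimal (fun p hp => ?_) (isClosed_le continuous_const continuous_snd)
      by_contra hneg
      exact hp (by simp only [hΦ0 p (not_le.1 hneg).le, mul_zero])
    · intro x
      simp only [hΦ0 (x, 0) le_rfl, mul_zero]
    · intro p _
      rw [hcancel, hmixed]
    · intro p _
      rw [hcancel, fderiv_fderiv_apply_comm (hΦ.of_le htwo), hmixed]
  · rintro ⟨φ, hφ, hφc, hφs, -, h1, h2⟩ x d -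
    have hzero := fderiv_eq_zero_of_tsupport_subset (hφ.of_le (by exact_mod_cast le_top)) hφs
    have key : ∀ c e : ℝ × ℝ, 0 < c.2 →
        (∀ p : ℝ × ℝ, 0 ≤ p.2 → f p = fderiv ℝ (fun q => D⁻¹ * fderiv ℝ φ q e) p c) →
        ∀ y : ℝ, ∫ t in Ioi (0:ℝ), f ((y, 0) + t • c) = 0 := by
      intro c e hc hfc y
      have hc0 : c ≠ 0 := fun h => by simp [h] at hc
      have hg : ContDiff ℝ 1 fun q => D⁻¹ * fderiv ℝ φ q e :=
        contDiff_const.mul ((hφ.fderiv_right (m := 1) (WithTop.coe_le_coe.2 le_top)).clm_apply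
          contDiff_const)
      have hgc : HasCompactSupport fun q => D⁻¹ * fderiv ℝ φ q e :=
        (hφc.fderiv_apply (𝕜 := ℝ) e).mul_left
      have hray := integral_ray_eq_neg hg hgc hc0 (y, 0)
      rw [hzero] at hray
      simp only [zero_apply, mul_zero, neg_zero] at hray
      refine Eq.trans ?_ hray
      refine setIntegral_congr_fun measurableSet_Ioi fun t ht => hfc _ ?_
      simpa using (mul_pos ht hc).le
    rw [hR', key a b ha2 h1, key b a hb2 h2, add_zero]
end

section
/- Let u : ℝ² → ℝ² be a smooth unit vector field whose integral curves are straight lines, i.e. u(p + t·u(p)) = u(p) for all p ∈ ℝ² and all t ≥ 0, and let f ∈ C_c^∞(ℝ²). Define ψ(p) = −∫₀^∞ f(p + t·u(p)) dt. Then ψ is smooth and (u(p)·∇)ψ(p) = f(p) for all p ∈ ℝ². -/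
open MeasureTheory Set

section RayTransform

variable {E : Type*} [NormedAddCommGroup E] [NormedSpace ℝ E]

/-- A compactly supported function vanishes along every ray with direction of norm at least `c`
beyond a length that is uniform over bounded sets of starting points. -/
lemma HasCompactSupport.exists_eq_zero_of_lt_abs {f : E → ℝ} (hf : HasCompactSupport f)
    {c : ℝ} (hc : 0 < c) (A : ℝ) :
    ∃ T : ℝ, ∀ p v : E, ‖p‖ ≤ A → c ≤ ‖v‖ → ∀ t : ℝ, T < |t| → f (p + t • v) = 0 := by
  obtain ⟨R, hR⟩ := hf.isBounded.subset_closedBall (0 : E)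
  refine ⟨(R + A) / c, fun p v hp hv t ht ↦ image_eq_zero_of_notMem_tsupport fun hmem ↦ ?_⟩
  have hle : ‖p + t • v‖ ≤ R := by simpa using hR hmem
  have htv : ‖t • v‖ ≤ ‖p + t • v‖ + ‖p‖ := by
    simpa using norm_sub_le (p + t • v) p
  rw [norm_smul, Real.norm_eq_abs] at htv
  rw [div_lt_iff₀ hc] at ht
  nlinarith [mul_le_mul_of_nonneg_left hv (abs_nonneg t)]

lemma HasCompactSupport.comp_line {f : E → ℝ} (hf : HasCompactSupport f) (p : E) {v : E}
    (hv : v ≠ 0) : HasCompactSupport fun t : ℝ ↦ f (p + t • v) := by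
  obtain ⟨T, hT⟩ := hf.exists_eq_zero_of_lt_abs (norm_pos_iff.2 hv) ‖p‖
  refine HasCompactSupport.intro (isCompact_closedBall (0 : ℝ) T) fun t ht ↦
    hT p v le_rfl le_rfl t ?_
  simpa using ht

/-- The integral of a smooth compactly supported function along rays depends smoothly on the
starting point, if the direction does and stays away from zero. -/
lemma contDiff_integral_ray {u : E → E} {n : ℕ∞} (hu : ContDiff ℝ n u) {c : ℝ} (hc : 0 < c)
    (huc : ∀ p, c ≤ ‖u p‖) {f : E → ℝ} (hf : ContDiff ℝ n f) (hfs : HasCompactSupport f) :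
    ContDiff ℝ n fun p ↦ ∫ t in Ioi (0 : ℝ), f (p + t • u p) := by
  rw [contDiff_iff_contDiffAt]
  intro p₀
  obtain ⟨T, hT⟩ := hfs.exists_eq_zero_of_lt_abs hc (‖p₀‖ + 1)
  have hsmooth : ContDiff ℝ n fun q : E × ℝ ↦ f (q.1 + q.2 • u q.1) :=
    hf.comp (contDiff_fst.add (contDiff_snd.smul (hu.comp contDiff_fst)))
  have hconv := contDiffOn_convolution_left_with_param_comp (𝕜 := ℝ) (n := n) (μ := volume)
    (ContinuousLinearMap.mul ℝ ℝ) (s := Metric.ball p₀ 1) (v := fun _ ↦ (0 : ℝ))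
    (f := (Iio (0 : ℝ)).indicator fun _ ↦ (1 : ℝ)) (g := fun p t ↦ f (p + t • u p))
    (k := Metric.closedBall 0 T) contDiffOn_const Metric.isOpen_ball (isCompact_closedBall _ _)
    (fun p t hp ht ↦ hT p (u p) ?_ (huc p) t (by simpa using ht))
    ((locallyIntegrable_const 1).indicator measurableSet_Iio) hsmooth.contDiffOn
  · refine (hconv.contDiffAt (Metric.ball_mem_nhds p₀ one_pos)).congr_of_eventuallyEq
      (.of_forall fun p ↦ ?_)
    simp only [convolution, ContinuousLinearMap.mul_apply']
    rw [← integral_indicator measurableSet_Ioi]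
    congr with t
    by_cases ht : 0 < t <;> simp [indicator, ht]
  · have : ‖p - p₀‖ < 1 := by simpa [dist_eq_norm] using hp
    linarith [norm_le_norm_add_norm_sub' p p₀]

/-- If the direction field is constant along its own rays, then the derivative of the ray integral
along the direction field is minus the integrand. -/
lemma fderiv_integral_ray {u : E → E} (hu : ∀ p, ∀ t : ℝ, 0 ≤ t → u (p + t • u p) = u p)
    {f : E → ℝ} (hf : Continuous f) (hfs : HasCompactSupport f) {p : E} (hup : u p ≠ 0)
    (hd : DifferentiableAt ℝ (fun q ↦ ∫ t in Ioi (0 : ℝ), f (q + t • u q)) p) :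
    fderiv ℝ (fun q ↦ ∫ t in Ioi (0 : ℝ), f (q + t • u q)) p (u p) = -f p := by
  set Φ : E → ℝ := fun q ↦ ∫ t in Ioi (0 : ℝ), f (q + t • u q)
  set F : ℝ → ℝ := fun t ↦ f (p + t • u p)
  have hF : Continuous F := by fun_prop
  have hFi : Integrable F := hF.integrable_of_hasCompactSupport (hfs.comp_line p hup)
  have hΦ : ∀ s : ℝ, 0 ≤ s → Φ (p + s • u p) = Φ p - ∫ t in (0 : ℝ)..s, F t := by
    intro s hs
    have hshift : Φ (p + s • u p) = ∫ t in Ioi s, F t := by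
      have := (measurePreserving_add_right volume s).setIntegral_preimage_emb
        (measurableEmbedding_addRight s) F (Ioi s)
      rw [← this]
      simp only [Φ, F, hu p s hs, preimage_add_const_Ioi, sub_self]
      congr with t
      rw [add_smul]
      congr 1
      abel
    rw [hshift, ← intervalIntegral.integral_Ioi_sub_Ioi hFi.integrableOn hs]
    simp only [Φ, F, sub_sub_cancel]
  have hray : HasDerivAt (fun s : ℝ ↦ p + s • u p) (u p) 0 := by
    simpa using ((hasDerivAt_id (0 : ℝ)).smul_const (u p)).const_add p
  have hchain : HasDerivAt (fun s : ℝ ↦ Φ (p + s • u p)) (fderiv ℝ Φ p (u p)) 0 := by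
    have hΦp : HasFDerivAt Φ (fderiv ℝ Φ p) (p + (0 : ℝ) • u p) := by
      rw [zero_smul, add_zero]
      exact hd.hasFDerivAt
    exact hΦp.comp_hasDerivAt (0 : ℝ) hray
  have hint : HasDerivAt (fun s : ℝ ↦ Φ p - ∫ t in (0 : ℝ)..s, F t) (-F 0) 0 := by
    simpa using (hF.integral_hasStrictDerivAt 0 0).hasDerivAt.const_sub (Φ p)
  have hright := hint.hasDerivWithinAt (s := Ici 0) |>.congr (fun s hs ↦ hΦ s hs) (hΦ 0 le_rfl)
  simpa [F] using (uniqueDiffWithinAt_Ici (0 : ℝ)).eq_deriv _ hchain.hasDerivWithinAt hright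

end RayTransform

/-- Beam potential for a vector field with straight integral curves:
    ψ(p) = −∫₀^∞ f(p + t·u(p)) dt is smooth and satisfies (u·∇)ψ = f. -/
theorem stmt_11
    (u : ℝ × ℝ → ℝ × ℝ)
    (hu_smooth : ContDiff ℝ (⊤ : ℕ∞) u)
    (hu_unit : ∀ p, (u p).1 ^ 2 + (u p).2 ^ 2 = 1)
    (hu_lines : ∀ (p : ℝ × ℝ) (t : ℝ), 0 ≤ t → u (p + t • u p) = u p)
    (f : ℝ × ℝ → ℝ) (hf_smooth : ContDiff ℝ (⊤ : ℕ∞) f)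
    (hf_supp : HasCompactSupport f)
    (ψ : ℝ × ℝ → ℝ)
    (hψ : ∀ p : ℝ × ℝ, ψ p = -∫ t in Ioi (0:ℝ), f (p + t • u p)) :
    ContDiff ℝ (⊤ : ℕ∞) ψ ∧ ∀ p : ℝ × ℝ, fderiv ℝ ψ p (u p) = f p := by
  have hnorm : ∀ p, 1 / 2 ≤ ‖u p‖ := by
    intro p
    by_contra! h
    obtain ⟨h₁, h₂⟩ := max_lt_iff.1 h
    rw [Real.norm_eq_abs] at h₁ h₂
    nlinarith [hu_unit p, sq_abs (u p).1, sq_abs (u p).2, abs_nonneg (u p).1, abs_nonneg (u p).2]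
  have hsmooth := contDiff_integral_ray hu_smooth one_half_pos hnorm hf_smooth hf_supp
  obtain rfl : ψ = fun p ↦ -∫ t in Ioi (0 : ℝ), f (p + t • u p) := funext hψ
  refine ⟨hsmooth.neg, fun p ↦ ?_⟩
  have hup : u p ≠ 0 := norm_pos_iff.1 (one_half_pos.trans_le (hnorm p))
  rw [fderiv_fun_neg, _root_.neg_apply,
    fderiv_integral_ray hu_lines hf_smooth.continuous hf_supp hup
      (hsmooth.differentiable (by simp) p), neg_neg]
end

section
/- In the setting of the fixed-direction head wave transform, fix θ₀ ∈ S^{n−2} and let λ_v : ℝ^{n−1} → ℝ be smooth and positive, β(x') = 1 − 1/λ_v(x'), and let f̃ ∈ C_c^∞(ℝ^{n−1}). Fix x' ∈ ℝ^{n−1} and assume that D_{θ₀}β(x' + sθ₀) converges to a limit C ∈ ℝ \ {0} as s → −∞. Then lim_{s→−∞} ∂_d R(x' + sθ₀, d)|_{d=0} = −C·∫_{−∞}^∞ f̃(x' + tθ₀) dt; that is, the limit of the d-derivative of the head wave data along the gliding direction recovers −C times the X-ray transform of f̃ along the line through x' in direction θ₀, where ∂_d R(y',d)|_{d=0} = β(y')·f̃(y')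 − D_{θ₀}β(y')·∫₀^∞ f̃(y' + tθ₀) dt. -/
open MeasureTheory Set Filter

/-- A compactly supported function vanishes far back along every line with unit direction. -/
theorem HasCompactSupport.exists_forall_lt_line_eq_zero {E : Type*} [NormedAddCommGroup E]
    [NormedSpace ℝ E] {f : E → ℝ} (hf : HasCompactSupport f) (x θ : E) (hθ : ‖θ‖ = 1) :
    ∃ r : ℝ, ∀ t < r, f (x + t • θ) = 0 := by
  obtain ⟨R, hR⟩ := hf.isCompact.isBounded.subset_closedBall x
  refine ⟨-R, fun t ht => ?_⟩
  by_contra h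
  have hmem := hR (subset_tsupport f h)
  rw [Metric.mem_closedBall, dist_self_add_left, norm_smul, hθ, mul_one, Real.norm_eq_abs] at hmem
  linarith [neg_abs_le t]

/-- A half-line integral started before the support is the integral over the whole line. -/
theorem setIntegral_Ioi_zero_line_eq_integral {E : Type*} [NormedAddCommGroup E]
    [NormedSpace ℝ E] {f : E → ℝ} {x θ : E} {r s : ℝ} (hr : ∀ t < r, f (x + t • θ) = 0)
    (hs : s < r) :
    ∫ t in Ioi (0 : ℝ), f (x + s • θ + t • θ) = ∫ t : ℝ, f (x + t • θ) := by
  simp only [add_assoc, ← add_smul]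
  rw [setIntegral_eq_integral_of_forall_compl_eq_zero,
    integral_add_left_eq_self (fun t : ℝ => f (x + t • θ)) s]
  intro t ht
  exact hr _ (by linarith [notMem_Ioi.mp ht])

/-- The limit of the d-derivative of the fixed-direction head wave data along the
    gliding direction recovers (−C times) the X-ray transform of f̃. -/
theorem stmt_14
    (n : ℕ) (hn : 3 ≤ n)
    (θ₀ : EuclideanSpace ℝ (Fin (n - 1))) (hθ₀ : ‖θ₀‖ = 1)
    (lv : EuclideanSpace ℝ (Fin (n - 1)) → ℝ)
    (hlv_smooth : ContDiff ℝ (⊤ : ℕ∞) lv) (hlv_pos : ∀ x', 0 < lv x')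
    (β : EuclideanSpace ℝ (Fin (n - 1)) → ℝ)
    (hβ : ∀ x', β x' = 1 - 1 / lv x')
    (ftil : EuclideanSpace ℝ (Fin (n - 1)) → ℝ)
    (hftil_smooth : ContDiff ℝ (⊤ : ℕ∞) ftil) (hftil_supp : HasCompactSupport ftil)
    (x' : EuclideanSpace ℝ (Fin (n - 1)))
    (C : ℝ) (hC : C ≠ 0)
    (hlim : Tendsto (fun s : ℝ => fderiv ℝ β (x' + s • θ₀) θ₀) atBot (nhds C))
    (D : EuclideanSpace ℝ (Fin (n - 1)) → ℝ)
    (hD : ∀ y', D y' =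
      β y' * ftil y' - fderiv ℝ β y' θ₀ * ∫ t in Ioi (0:ℝ), ftil (y' + t • θ₀)) :
    Tendsto (fun s : ℝ => D (x' + s • θ₀)) atBot
      (nhds (-C * ∫ t : ℝ, ftil (x' + t • θ₀))) := by
  obtain ⟨r, hr⟩ := hftil_supp.exists_forall_lt_line_eq_zero x' θ₀ hθ₀
  rw [neg_mul]
  refine (hlim.mul_const _).neg.congr' ?_
  filter_upwards [eventually_lt_atBot r] with s hs
  rw [hD, hr s hs, setIntegral_Ioi_zero_line_eq_integral hr hs, mul_zero, zero_sub]
end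

section
/- Let n ≥ 3 and let u, v ∈ ℝⁿ be constant unit vectors with uₙ > 0 and vₙ > 0. Let h : ℝ → ℝ be a smooth function with h(0) = 0, h'(0) = 0, h' integrable on [0,∞), and h(x) → 0 as x → +∞. Define p : ℝⁿ → ℝ by p(x', xₙ) = h'(xₙ). Then the head wave transform of p vanishes identically: for all x' ∈ ℝ^{n−1}, d ≥ 0 and θ ∈ S^{n−2}, ∫₀^∞ h'(t·uₙ) dt + ∫₀^d h'(0) dt + ∫₀^∞ h'(t·vₙ) dt = 0. Consequently, for every f for which the head wave transform is defined, R(f + p) = Rf, so even full head wave data does not determine f uniquely. -/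
open MeasureTheory Set

/-- The derivative of a function vanishing at `0` and at infinity integrates to zero over the
    half-line, also after a positive rescaling of the variable. -/
theorem integral_Ioi_deriv_mul_eq_zero {h : ℝ → ℝ} (hd : Differentiable ℝ h) (h0 : h 0 = 0)
    (hint : IntegrableOn (deriv h) (Ioi (0 : ℝ)))
    (hlim : Filter.Tendsto h Filter.atTop (nhds 0)) {c : ℝ} (hc : 0 < c) :
    ∫ t in Ioi (0 : ℝ), deriv h (t * c) = 0 := by
  have key : ∫ t in Ioi (0 : ℝ), deriv h t = 0 := by
    rw [integral_Ioi_of_hasDerivAt_of_tendsto' (fun x _ => (hd x).hasDerivAt) hint hlim, h0,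
      sub_zero]
  rw [integral_comp_mul_right_Ioi (deriv h) 0 hc, zero_mul, key, smul_zero]

/-- Non-uniqueness for the full-data head wave transform in dimension n ≥ 3: the head
    wave transform of p(x', xₙ) = h'(xₙ) vanishes identically, hence R(f + p) = Rf. -/
theorem stmt_17
    (n : ℕ) (hn : 3 ≤ n)
    (u' v' : EuclideanSpace ℝ (Fin (n - 1))) (un vn : ℝ)
    (hu_unit : ‖u'‖ ^ 2 + un ^ 2 = 1) (hv_unit : ‖v'‖ ^ 2 + vn ^ 2 = 1)
    (hun : 0 < un) (hvn : 0 < vn)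
    (h : ℝ → ℝ) (hh_smooth : ContDiff ℝ (⊤ : ℕ∞) h)
    (hh0 : h 0 = 0) (hh0' : deriv h 0 = 0)
    (hh_int : IntegrableOn (deriv h) (Ioi (0:ℝ)))
    (hh_lim : Filter.Tendsto h Filter.atTop (nhds 0))
    (p : EuclideanSpace ℝ (Fin (n - 1)) × ℝ → ℝ)
    (hp : ∀ q : EuclideanSpace ℝ (Fin (n - 1)) × ℝ, p q = deriv h q.2)
    (R : (EuclideanSpace ℝ (Fin (n - 1)) × ℝ → ℝ) →
      EuclideanSpace ℝ (Fin (n - 1)) → ℝ → EuclideanSpace ℝ (Fin (n - 1)) → ℝ)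
    (hR : ∀ (g : EuclideanSpace ℝ (Fin (n - 1)) × ℝ → ℝ) (x' : EuclideanSpace ℝ (Fin (n - 1)))
        (d : ℝ) (θ : EuclideanSpace ℝ (Fin (n - 1))), R g x' d θ =
      (∫ t in Ioi (0:ℝ), g ((x', 0) + t • (u', un)))
      + (∫ t in (0:ℝ)..d, g (x' + t • θ, 0))
      + ∫ t in Ioi (0:ℝ), g ((x' + d • θ, 0) + t • (v', vn))) :
    (∀ (x' : EuclideanSpace ℝ (Fin (n - 1))) (d : ℝ) (θ : EuclideanSpace ℝ (Fin (n - 1))),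
      0 ≤ d → ‖θ‖ = 1 → R p x' d θ = 0) ∧
    (∀ (f : EuclideanSpace ℝ (Fin (n - 1)) × ℝ → ℝ) (x' : EuclideanSpace ℝ (Fin (n - 1)))
        (d : ℝ) (θ : EuclideanSpace ℝ (Fin (n - 1))), 0 ≤ d → ‖θ‖ = 1 →
      IntegrableOn (fun t : ℝ => f ((x', 0) + t • (u', un))) (Ioi (0:ℝ)) →
      IntegrableOn (fun t : ℝ => f ((x' + d • θ, 0) + t • (v', vn))) (Ioi (0:ℝ)) →
      R (fun q => f q + p q) x' d θ = R f x' d θ) := by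
  have hd : Differentiable ℝ h := hh_smooth.differentiable (by simp)
  have integral_zero {c : ℝ} (hc : 0 < c) : ∫ t in Ioi (0 : ℝ), deriv h (t * c) = 0 :=
    integral_Ioi_deriv_mul_eq_zero hd hh0 hh_int hh_lim hc
  have integrable {c : ℝ} (hc : 0 < c) :
      IntegrableOn (fun t => deriv h (t * c)) (Ioi (0 : ℝ)) := by
    rw [integrableOn_Ioi_comp_mul_right_iff (deriv h) 0 hc, zero_mul]
    exact hh_int
  have p_ray (x w : EuclideanSpace ℝ (Fin (n - 1))) (c t : ℝ) :
      p ((x, 0) + t • (w, c)) = deriv h (t * c) := by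
    simp [hp]
  have p_surface (x : EuclideanSpace ℝ (Fin (n - 1))) : p (x, 0) = 0 := by
    rw [hp, hh0']
  refine ⟨fun x' d θ _ _ => ?_, fun f x' d θ _ _ hfu hfv => ?_⟩
  · simp only [hR, p_ray, p_surface, integral_zero hun, integral_zero hvn,
      intervalIntegral.integral_zero, add_zero]
  · simp only [hR, p_ray, p_surface, add_zero]
    rw [integral_add hfu (integrable hun), integral_add hfv (integrable hvn),
      integral_zero hun, integral_zero hvn, add_zero, add_zero]
end
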